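/- arXiv:2003.07349 — 11 statements merged into one kernel-verified Lean document; each statement's English description precedes it below -/
import Mathlib

section
/- Let (E,r) be a ranked set (E a finite set, r : 2^E → ℤ any function) carrying two multiplicities m₁, m₂ : 2^E → K over a field K, and let m₁m₂ denote the pointwise product multiplicity. Then for all t, s ∈ K with t ≠ 0 and s ≠ 0 and all families u = (u_e)_{e∈E}, v = (v_e)_{e∈E} in K: Z_{(E,r,m₁m₂)}(ts, (u_e v_e)_{e∈E}) = ∑_{A ⊆ E} s^{−r(A)} · (∏_{e∈A} (−v_e)) · Z_{(E,r,m₁)|A}(t, (−u_e)_{e∈E}) · Z_{(E,r,m₂)/A}(s, v). -/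
open Finset

/-- The multivariate Tutte polynomial `Z_M(q,v) = ∑_{A⊆E} m(A) q^{−r(A)} v^A` of the
ranked set with multiplicity `M = (E, r, m)`, where the ground set `E` is a finite
type `α` and subsets of `E` are `Finset α`. -/
noncomputable def Zmulti {α K : Type*} [Fintype α] [Field K]
    (r : Finset α → ℤ) (m : Finset α → K) (q : K) (v : α → K) : K :=
  ∑ A : Finset α, m A * q ^ (-(r A)) * ∏ e ∈ A, v e

/-- `Z_{M|A}(q,u) = ∑_{B⊆A} m(B) q^{−r(B)} u^B`, the multivariate Tutte polynomial of
the restriction `M|A`. -/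
noncomputable def ZmultiRes {α K : Type*} [Field K]
    (r : Finset α → ℤ) (m : Finset α → K) (A : Finset α) (q : K) (u : α → K) : K :=
  ∑ B ∈ A.powerset, m B * q ^ (-(r B)) * ∏ e ∈ B, u e

/-- `Z_{M/A}(q,v) = ∑_{B⊆E∖A} m(A∪B) q^{r(A)−r(A∪B)} v^B`, the multivariate Tutte
polynomial of the contraction `M/A`. -/
noncomputable def ZmultiCon {α K : Type*} [Fintype α] [DecidableEq α] [Field K]
    (r : Finset α → ℤ) (m : Finset α → K) (A : Finset α) (q : K) (v : α → K) : K :=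
  ∑ B ∈ Aᶜ.powerset, m (A ∪ B) * q ^ (r A - r (A ∪ B)) * ∏ e ∈ B, v e

/-- The alternating sum over an interval of the Boolean lattice. -/
theorem sum_Icc_neg_one_pow_card {α R : Type*} [DecidableEq α] [CommRing R]
    {B C : Finset α} (h : B ⊆ C) :
    ∑ A ∈ Finset.Icc B C, (-1 : R) ^ A.card = if B = C then (-1) ^ B.card else 0 := by
  have hdisj : ∀ D ∈ (C \ B).powerset, Disjoint B D := fun D hD =>
    disjoint_sdiff.mono_right (mem_powerset.1 hD)
  have hinj : Set.InjOn (fun D => B ∪ D) ((C \ B).powerset : Set (Finset α)) := by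
    intro D hD D' hD' heq
    rw [← (hdisj D hD).sup_sdiff_cancel_left, ← (hdisj D' hD').sup_sdiff_cancel_left]
    exact congrArg (· \ B) heq
  have hsum := congrArg (Int.cast : ℤ → R) (sum_powerset_neg_one_pow_card (x := C \ B))
  push_cast at hsum
  rw [Icc_eq_image_powerset h, sum_image hinj]
  rw [sum_congr rfl fun D hD => by rw [card_union_of_disjoint (hdisj D hD), pow_add],
    ← mul_sum, hsum]
  have hiff : C \ B = ∅ ↔ B = C := by
    rw [sdiff_eq_empty_iff_subset]
    exact ⟨h.antisymm, fun h' => h'.ge⟩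
  simp [hiff]

/-- The contraction polynomial as a sum over the supersets of the contracted set. -/
theorem prod_neg_mul_ZmultiCon {α K : Type*} [Fintype α] [DecidableEq α] [Field K]
    (r : Finset α → ℤ) (m : Finset α → K) (A : Finset α) {q : K} (hq : q ≠ 0) (v : α → K) :
    q ^ (-(r A)) * (∏ e ∈ A, (-v e)) * ZmultiCon r m A q v =
      (-1) ^ A.card * ∑ C ∈ univ.filter (A ⊆ ·), m C * q ^ (-(r C)) * ∏ e ∈ C, v e := by
  rw [ZmultiCon, mul_sum, mul_sum]
  refine sum_bij' (fun B _ => A ∪ B) (fun C _ => C \ A) ?_ ?_ ?_ ?_ ?_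
  · intro B _
    simp
  · intro C _
    simp [subset_iff]
  · intro B hB
    have hdisj : Disjoint A B := disjoint_compl_right.mono_right (mem_powerset.1 hB)
    exact hdisj.sup_sdiff_cancel_left
  · intro C hC
    exact union_sdiff_of_subset (mem_filter.1 hC).2
  · intro B hB
    have hdisj : Disjoint A B := disjoint_compl_right.mono_right (mem_powerset.1 hB)
    have hpow : q ^ (-(r (A ∪ B))) = q ^ (-(r A)) * q ^ (r A - r (A ∪ B)) := by
      rw [← zpow_add₀ hq]
      congr 1
      ring
    rw [prod_union hdisj, prod_neg, hpow]
    ring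

/-- **Theorem 3.4** (generalized Kung convolution formula): for a ranked set `(E,r)` with
two multiplicities `m₁, m₂` over a field `K`, `t, s ≠ 0`, and families `u, v`,
`Z_{(E,r,m₁m₂)}(ts, uv) = ∑_{A⊆E} s^{−r(A)} (−v)^A · Z_{(E,r,m₁)|A}(t, −u) · Z_{(E,r,m₂)/A}(s, v)`. -/
theorem convolution_Zmulti {α K : Type*} [Fintype α] [DecidableEq α] [Field K]
    (r : Finset α → ℤ) (m₁ m₂ : Finset α → K) (t s : K) (ht : t ≠ 0) (hs : s ≠ 0)
    (u v : α → K) :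
    Zmulti r (fun A => m₁ A * m₂ A) (t * s) (fun e => u e * v e) =
      ∑ A : Finset α, s ^ (-(r A)) * (∏ e ∈ A, (-v e)) *
        ZmultiRes r m₁ A t (fun e => -u e) * ZmultiCon r m₂ A s v := by
  calc
    _ = ∑ B : Finset α, ∑ C : Finset α, if B = C then
          (m₁ B * t ^ (-(r B)) * ∏ e ∈ B, u e) * (m₂ C * s ^ (-(r C)) * ∏ e ∈ C, v e)
        else 0 := by
      rw [Zmulti]
      refine sum_congr rfl fun B _ => ?_
      rw [sum_ite_eq, if_pos (mem_univ B), mul_zpow, prod_mul_distrib]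
      ring
    _ = ∑ B : Finset α, ∑ C : Finset α, ∑ A ∈ Finset.Icc B C, (-1) ^ A.card *
          (m₁ B * t ^ (-(r B)) * ∏ e ∈ B, (-u e)) *
            (m₂ C * s ^ (-(r C)) * ∏ e ∈ C, v e) := by
      refine sum_congr rfl fun B _ => sum_congr rfl fun C _ => ?_
      rw [← sum_mul, ← sum_mul]
      by_cases h : B ⊆ C
      · rw [sum_Icc_neg_one_pow_card h, prod_neg]
        split_ifs
        · have hsq : ((-1 : K) ^ B.card) * (-1) ^ B.card = 1 := by
            rw [← mul_pow]
            simp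
          linear_combination -(m₁ B * t ^ (-(r B)) * ∏ e ∈ B, u e) *
            (m₂ C * s ^ (-(r C)) * ∏ e ∈ C, v e) * hsq
        · simp
      · rw [if_neg fun h' => h h'.le, Finset.Icc_eq_empty h]
        simp
    _ = ∑ A : Finset α, ∑ B ∈ A.powerset, ∑ C ∈ univ.filter (A ⊆ ·), (-1) ^ A.card *
          (m₁ B * t ^ (-(r B)) * ∏ e ∈ B, (-u e)) *
            (m₂ C * s ^ (-(r C)) * ∏ e ∈ C, v e) := by
      rw [sum_congr rfl fun B _ => sum_comm' (t' := univ.filter (B ⊆ ·))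
        (s' := fun A => univ.filter (A ⊆ ·)) (by simp [and_comm])]
      exact sum_comm' (by simp)
    _ = _ := by
      refine sum_congr rfl fun A _ => ?_
      rw [mul_right_comm, prod_neg_mul_ZmultiCon r m₂ A hs v, ZmultiRes, mul_sum]
      refine sum_congr rfl fun B _ => ?_
      rw [← mul_sum]
      ring
end

section
/- Let M=(E,r,m) be an rsm over a field K and t ∈ K with t ≠ 0. Define the rank monomial X_{M|A}(t) := m(A) t^{−r(A)} for A ⊆ E. Then for every family p=(p_e)_{e∈E} in K with p_e ≠ 1 for all e: E[X_{M|E_p}(t)] = ∑_{A⊆E} m(A) t^{−r(A)} p^A (1−p)^{E∖A} = (1−p)^E · Z_M(t, (p_e/(1−p_e))_{e∈E}). Moreover, if p_e = p for all e with p ≠ 0 and p ≠ 1, then E[X_{M|E_p}(t)] = p^{r(E)} (1−p)^{|E|−r(E)} t^{−r(E)} T_M(1 + t(1−p)/p, 1/(1−p)). -/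
open Finset

/-- The Tutte polynomial `T_M(x,y) = ∑_{A⊆E} m(A)(x−1)^{r(E)−r(A)}(y−1)^{|A|−r(A)}`
(integer powers) of the rsm `M = (E, r, m)`. -/
noncomputable def Tutte {α K : Type*} [Fintype α] [Field K]
    (r : Finset α → ℤ) (m : Finset α → K) (x y : K) : K :=
  ∑ A : Finset α, m A * (x - 1) ^ (r Finset.univ - r A) * (y - 1) ^ ((A.card : ℤ) - r A)

/-- **Theorem 3.5** (monomial model, rank monomial): for an rsm `M = (E,r,m)` over a field `K`,
`t ≠ 0` and a family `p` with `p_e ≠ 1`, the expectation of the rank monomial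
`X_{M|A}(t) = m(A) t^{−r(A)}` of the random restriction satisfies
`E[X_{M|E_p}(t)] = ∑_{A⊆E} m(A) t^{−r(A)} p^A (1−p)^{E∖A} = (1−p)^E · Z_M(t, p/(1−p))`.
Moreover, if all `p_e = c` with `c ≠ 0, 1`, then
`E[X_{M|E_p}(t)] = c^{r(E)} (1−c)^{|E|−r(E)} t^{−r(E)} T_M(1 + t(1−c)/c, 1/(1−c))`. -/
theorem expectation_rank_monomial {α K : Type*} [Fintype α] [DecidableEq α] [Field K]
    (r : Finset α → ℤ) (m : Finset α → K) (t : K) (ht : t ≠ 0)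
    (p : α → K) (hp : ∀ e, p e ≠ 1) :
    ((∑ A : Finset α, m A * t ^ (-(r A)) * (∏ e ∈ A, p e) * ∏ e ∈ Aᶜ, (1 - p e)) =
        (∏ e : α, (1 - p e)) * Zmulti r m t (fun e => p e / (1 - p e))) ∧
      (∀ c : K, c ≠ 0 → c ≠ 1 → (∀ e, p e = c) →
        (∑ A : Finset α, m A * t ^ (-(r A)) * (∏ e ∈ A, p e) * ∏ e ∈ Aᶜ, (1 - p e)) =
          c ^ (r Finset.univ) * (1 - c) ^ ((Fintype.card α : ℤ) - r Finset.univ) *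
            t ^ (-(r Finset.univ)) *
            Tutte r m (1 + t * (1 - c) / c) (1 / (1 - c))) := by
  constructor
  · rw [Zmulti, mul_sum]
    refine sum_congr rfl fun A _ => ?_
    have hA : ∏ e ∈ A, (1 - p e) ≠ 0 :=
      prod_ne_zero_iff.mpr fun e _ => sub_ne_zero.mpr (hp e).symm
    rw [prod_div_distrib, ← prod_mul_prod_compl A fun e => 1 - p e]
    field_simp
  · intro c hc0 hc1 hpc
    have hc : 1 - c ≠ 0 := sub_ne_zero.mpr hc1.symm
    have hx : 1 + t * (1 - c) / c - 1 = t * (1 - c) / c := by ring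
    have hy : 1 / (1 - c) - 1 = c / (1 - c) := by
      field_simp
      ring
    rw [Tutte, mul_sum, hx, hy]
    refine sum_congr rfl fun A _ => ?_
    simp only [hpc, prod_const]
    rw [← card_add_card_compl A]
    push_cast
    simp only [div_zpow, mul_zpow, zpow_sub₀ ht, zpow_sub₀ hc, zpow_sub₀ hc0, zpow_add₀ hc,
      zpow_neg, zpow_natCast]
    field_simp
end

section
/- Let Γ be a finitely generated abelian group, E a finite indexed family of elements of Γ, and F a finite abelian group. For A ⊆ E let ⟨A⟩ be the subgroup of Γ generated by A, r(A) := rank(⟨A⟩), r(Γ) := rank(Γ), and m^F(A) := |Hom((Γ/⟨A⟩)_tor, F)|, the number of group homomorphisms from the torsion subgroup of Γ/⟨A⟩ to F. Then for every real p with 0 < p < 1: ∑_{A⊆E} |Hom(Γ/⟨A⟩, F)| · p^{|A|} (1−p)^{|E|−|A|} = |F|^{r(Γ)−r(E)} p^{r(E)} (1−p)^{|E|−r(E)} · T_M(1 + |F|(1−p)/p, 1/(1−p)), where T_M is the Tutte polynomial of the rsm M=(E, r, m^F) over ℝ (all cardinalities are finite and are cast to real numbers). -/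
open Finset

/-- A finitely generated abelian group splits as its torsion subgroup times a free group, so
homomorphisms to a finite group `F` are counted by those on the torsion and the rank. -/
theorem card_addMonoidHom_eq_card_torsion_mul_pow (G F : Type*) [AddCommGroup G] [AddGroup.FG G]
    [AddCommGroup F] :
    Nat.card (G →+ F) =
      Nat.card (↥(AddCommGroup.torsion G) →+ F) * Nat.card F ^ Module.finrank ℤ G := by
  have : Module.Finite ℤ G := Module.Finite.iff_addGroup_fg.mpr inferInstance
  obtain ⟨n, ⟨g⟩⟩ :=
    Module.basisOfFiniteTypeTorsionFree' (R := ℤ) (M := G ⧸ Submodule.torsion ℤ G)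
  obtain ⟨f, hf⟩ := Module.projective_lifting_property _ LinearMap.id
    (Submodule.torsion ℤ G).mkQ_surjective
  have e : (↥(Submodule.torsion ℤ G) × (G ⧸ Submodule.torsion ℤ G)) ≃ₗ[ℤ] G :=
    lequivProdOfRightSplitExact (Submodule.torsion ℤ G).injective_subtype
      (by rw [Submodule.range_subtype, Submodule.ker_mkQ]) hf
  have hrank : Module.finrank ℤ G = n := by
    rw [← finrank_quotient_eq_of_le_torsion (le_refl (Submodule.torsion ℤ G)),
      g.finrank_eq, Module.finrank_finsupp_self, Fintype.card_fin]
  have e₁ : (G →+ F) ≃ (G →ₗ[ℤ] F) := (addMonoidHomLequivInt ℤ).toEquiv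
  have e₂ : (G →ₗ[ℤ] F) ≃ (↥(Submodule.torsion ℤ G) × (G ⧸ Submodule.torsion ℤ G) →ₗ[ℤ] F) :=
    (e.symm.congrLeft F ℤ).toEquiv
  have e₃ : ((↥(Submodule.torsion ℤ G) →ₗ[ℤ] F) × ((G ⧸ Submodule.torsion ℤ G) →ₗ[ℤ] F)) ≃
      (↥(Submodule.torsion ℤ G) × (G ⧸ Submodule.torsion ℤ G) →ₗ[ℤ] F) :=
    (LinearMap.coprodEquiv ℤ).toEquiv
  have e₄ : (Fin n → F) ≃ ((G ⧸ Submodule.torsion ℤ G) →ₗ[ℤ] F) := ((Module.Basis.ofRepr g).constr ℤ).toEquiv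
  have e₅ : (↥(Submodule.torsion ℤ G) →+ F) ≃ (↥(Submodule.torsion ℤ G) →ₗ[ℤ] F) :=
    (addMonoidHomLequivInt ℤ).toEquiv
  have e₆ : (↥(Submodule.torsion ℤ G).toAddSubgroup →+ F) ≃ (↥(Submodule.torsion ℤ G) →+ F) :=
    Equiv.refl _
  rw [hrank, ← Submodule.torsion_int, Nat.card_congr e₆, Nat.card_congr e₁, Nat.card_congr e₂,
    ← Nat.card_congr e₃, Nat.card_prod, ← Nat.card_congr e₄, ← Nat.card_congr e₅, Nat.card_fun,
    Nat.card_fin]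

theorem AddSubgroup.finrank_int_quotient_add_finrank {G : Type*} [AddCommGroup G] [AddGroup.FG G]
    (H : AddSubgroup G) :
    Module.finrank ℤ (G ⧸ H) + Module.finrank ℤ ↥H = Module.finrank ℤ G := by
  have : Module.Finite ℤ G := Module.Finite.iff_addGroup_fg.mpr inferInstance
  exact Submodule.finrank_quotient_add_finrank (AddSubgroup.toIntSubmodule H)

/-- **Theorem 3.6** (Yoshinaga): let `Γ` be a finitely generated abelian group,
`E = (x_e)_{e∈α}` a finite indexed family of elements of `Γ`, and `F` a finite abelian
group.  With `⟨A⟩` the subgroup generated by `A`, `r(A) = rank ⟨A⟩`, `r(Γ) = rank Γ`,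
and `m^F(A) = |Hom((Γ/⟨A⟩)_tor, F)|`, for every real `0 < p < 1` we have
`∑_{A⊆E} |Hom(Γ/⟨A⟩,F)| p^{|A|} (1−p)^{|E|−|A|}
  = |F|^{r(Γ)−r(E)} p^{r(E)} (1−p)^{|E|−r(E)} T_M(1 + |F|(1−p)/p, 1/(1−p))`,
where `T_M` is the Tutte polynomial of the rsm `M = (E, r, m^F)` over `ℝ`. -/
theorem expected_number_of_homs {Γ : Type*} [AddCommGroup Γ] [AddGroup.FG Γ]
    {F : Type*} [AddCommGroup F] [Fintype F]
    {α : Type*} [Fintype α] [DecidableEq α] (x : α → Γ)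
    (rk : Finset α → ℤ)
    (hrk : ∀ A : Finset α, rk A = Module.finrank ℤ ↥(AddSubgroup.closure (x '' ↑A)))
    (mF : Finset α → ℝ)
    (hmF : ∀ A : Finset α, mF A =
      Nat.card (↥(AddCommGroup.torsion (Γ ⧸ AddSubgroup.closure (x '' ↑A))) →+ F))
    (p : ℝ) (hp0 : 0 < p) (hp1 : p < 1) :
    (∑ A : Finset α,
        (Nat.card ((Γ ⧸ AddSubgroup.closure (x '' ↑A)) →+ F) : ℝ) *
          p ^ A.card * (1 - p) ^ (Fintype.card α - A.card)) =
      (Fintype.card F : ℝ) ^ ((Module.finrank ℤ Γ : ℤ) - rk Finset.univ) *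
        p ^ (rk Finset.univ) *
        (1 - p) ^ ((Fintype.card α : ℤ) - rk Finset.univ) *
        ∑ A : Finset α,
          mF A * ((1 + (Fintype.card F : ℝ) * (1 - p) / p) - 1) ^ (rk Finset.univ - rk A) *
            ((1 / (1 - p)) - 1) ^ ((A.card : ℤ) - rk A) := by
  have hq : (Fintype.card F : ℝ) ≠ 0 := Nat.cast_ne_zero.mpr Fintype.card_ne_zero
  have hp : p ≠ 0 := hp0.ne'
  have hp' : 1 - p ≠ 0 := (sub_pos.mpr hp1).ne'
  have hy : 1 / (1 - p) - 1 = p / (1 - p) := by field_simp; ring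
  rw [Finset.mul_sum]
  refine Finset.sum_congr rfl fun A _ => ?_
  have hrank := AddSubgroup.finrank_int_quotient_add_finrank (AddSubgroup.closure (x '' ↑A))
  have hexp : (Module.finrank ℤ (Γ ⧸ AddSubgroup.closure (x '' ↑A)) : ℤ) =
      (Module.finrank ℤ Γ - rk univ) + (rk univ - rk A) := by
    rw [hrk A]
    omega
  have hcard : ((Fintype.card α - A.card : ℕ) : ℤ) =
      (Fintype.card α - rk univ) + (rk univ - rk A) - (A.card - rk A) := by
    have := A.card_le_univ
    omega
  have hcardA : (A.card : ℤ) = rk univ - (rk univ - rk A) + (A.card - rk A) := by ring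
  rw [card_addMonoidHom_eq_card_torsion_mul_pow, Nat.cast_mul, ← hmF, Nat.cast_pow,
    Nat.card_eq_fintype_card, ← zpow_natCast, hexp, zpow_add₀ hq,
    ← zpow_natCast (1 - p), hcard, zpow_sub₀ hp', zpow_add₀ hp', ← zpow_natCast p A.card]
  nth_rw 1 [hcardA]
  rw [zpow_add₀ hp, zpow_sub₀ hp, add_sub_cancel_left, hy, div_zpow, div_zpow, mul_zpow]
  ring
end

section
/- Let E be a finite indexed family of vectors in ℤ^n that are linearly independent over ℝ, and for A ⊆ E set m(A) := |(ℤ^n/⟨A⟩)_tor|. Let k=(k_e)_{e∈E} be positive integers. Then for every family of reals p=(p_e)_{e∈E} with p_e ≠ 1 for all e: ∑_{A⊆E} |Z(k·A)^⋄ ∩ ℤ^n| · p^A (1−p)^{E∖A} = (1−p)^E · Z_M(1, (k_e p_e/(1−p_e))_{e∈E}); equivalently, for all real p: ∑_{A⊆E} |Z(k·A)^⋄ ∩ ℤ^n| · p^A (1−p)^{E∖A} = ∑_{A⊆E} m(A) (∏_{e∈A} k_e) p^A (1−p)^{E∖A}. -/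
open Finset

/-- The number of lattice points of the half-open zonotope
`Z(k·A)^⋄ = { ∑_{e∈A} λ_e k_e x_e : 0 ≤ λ_e < 1 }` generated by the rescaled vectors
`k_e x_e` (`e ∈ A`), where `x : α → ℤ^n`. -/
noncomputable def halfOpenZonotopePts {α : Type*} {n : ℕ} (x : α → Fin n → ℤ)
    (k : α → ℤ) (A : Finset α) : ℕ :=
  Nat.card {z : Fin n → ℤ //
    ∃ lam : α → ℝ, (∀ e ∈ A, 0 ≤ lam e ∧ lam e < 1) ∧
      (fun i => (z i : ℝ)) = ∑ e ∈ A, lam e • ((k e : ℝ) • fun i => (x e i : ℝ))}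

section HalfOpenZonotope

variable {ι : Type*} [Fintype ι] {n : ℕ}

/-- The integer points lying in the real span of the integer vectors `y`. -/
def spanIntegerPoints (y : ι → Fin n → ℤ) : AddSubgroup (Fin n → ℤ) :=
  (Submodule.span ℝ (Set.range fun e i => (y e i : ℝ))).toAddSubgroup.comap
    ((Int.castAddHom ℝ).compLeft (Fin n))

lemma mem_spanIntegerPoints {y : ι → Fin n → ℤ} {z : Fin n → ℤ} :
    z ∈ spanIntegerPoints y ↔ ∃ c : ι → ℝ, ∀ i, (z i : ℝ) = ∑ e, c e * y e i := by
  simp only [spanIntegerPoints, AddSubgroup.mem_comap, Submodule.mem_toAddSubgroup,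
    Submodule.mem_span_range_iff_exists_fun, funext_iff, Finset.sum_apply, Pi.smul_apply,
    smul_eq_mul]
  exact exists_congr fun c => forall_congr' fun i => eq_comm

/-- The subgroup generated by the integer vectors `y`. -/
def integerLattice (y : ι → Fin n → ℤ) : AddSubgroup (Fin n → ℤ) :=
  (Fintype.linearCombination ℤ y).toAddMonoidHom.range

lemma mem_integerLattice {y : ι → Fin n → ℤ} {z : Fin n → ℤ} :
    z ∈ integerLattice y ↔ ∃ a : ι → ℤ, ∀ i, z i = ∑ e, a e * y e i := by
  simp only [integerLattice, AddMonoidHom.mem_range, LinearMap.toAddMonoidHom_coe,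
    Fintype.linearCombination_apply, funext_iff, Finset.sum_apply, Pi.smul_apply, smul_eq_mul]
  exact exists_congr fun c => forall_congr' fun i => eq_comm

lemma closure_range_eq_integerLattice (y : ι → Fin n → ℤ) :
    AddSubgroup.closure (Set.range y) = integerLattice y := by
  ext z
  rw [← Submodule.span_int_eq_addSubgroupClosure, Submodule.mem_toAddSubgroup,
    Submodule.mem_span_range_iff_exists_fun]
  rfl

lemma integerLattice_le_spanIntegerPoints (y : ι → Fin n → ℤ) :
    integerLattice y ≤ spanIntegerPoints y := by
  intro z hz
  obtain ⟨a, ha⟩ := mem_integerLattice.1 hz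
  exact mem_spanIntegerPoints.2 ⟨fun e => a e, fun i => by rw [ha i]; push_cast; rfl⟩

/-- The integer points of the half-open parallelepiped spanned by the vectors `y`. -/
def halfOpenBoxPoints (y : ι → Fin n → ℤ) : Set (Fin n → ℤ) :=
  {z | ∃ c : ι → ℝ, (∀ e, 0 ≤ c e ∧ c e < 1) ∧ ∀ i, (z i : ℝ) = ∑ e, c e * y e i}

lemma finite_halfOpenBoxPoints (y : ι → Fin n → ℤ) : (halfOpenBoxPoints y).Finite := by
  refine (Set.finite_Icc (fun i => -∑ e, |y e i|) (fun i => ∑ e, |y e i|)).subset ?_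
  rintro z ⟨c, hc, hz⟩
  have key : ∀ i, |z i| ≤ ∑ e, |y e i| := by
    intro i
    have h : |(z i : ℝ)| ≤ ∑ e, |(y e i : ℝ)| := by
      rw [hz i]
      refine (Finset.abs_sum_le_sum_abs _ _).trans (Finset.sum_le_sum fun e _ => ?_)
      rw [abs_mul, abs_of_nonneg (hc e).1]
      exact mul_le_of_le_one_left (abs_nonneg _) (hc e).2.le
    exact_mod_cast h
  exact ⟨fun i => (abs_le.1 (key i)).1, fun i => (abs_le.1 (key i)).2⟩

lemma exists_mem_halfOpenBoxPoints_sub_mem {y : ι → Fin n → ℤ} {z : Fin n → ℤ}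
    (hz : z ∈ spanIntegerPoints y) :
    ∃ w ∈ halfOpenBoxPoints y, z - w ∈ integerLattice y := by
  obtain ⟨c, hc⟩ := mem_spanIntegerPoints.1 hz
  refine ⟨fun i => z i - ∑ e, ⌊c e⌋ * y e i, ⟨fun e => Int.fract (c e),
    fun e => ⟨Int.fract_nonneg _, Int.fract_lt_one _⟩, fun i => ?_⟩,
    mem_integerLattice.2 ⟨fun e => ⌊c e⌋, fun i => by simp⟩⟩
  push_cast
  rw [hc i, ← Finset.sum_sub_distrib]
  exact Finset.sum_congr rfl fun e _ => by rw [Int.fract]; ring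

lemma torsion_quotient_integerLattice (y : ι → Fin n → ℤ) :
    AddCommGroup.torsion ((Fin n → ℤ) ⧸ integerLattice y) =
      (spanIntegerPoints y).map (QuotientAddGroup.mk' (integerLattice y)) := by
  ext q
  induction q using QuotientAddGroup.induction_on with
  | H z =>
  rw [AddCommGroup.mem_torsion, AddSubgroup.mem_map]
  constructor
  · intro h
    obtain ⟨k, hk, hkz⟩ := isOfFinAddOrder_iff_nsmul_eq_zero.1 h
    refine ⟨z, ?_, rfl⟩
    rw [← QuotientAddGroup.mk_nsmul, QuotientAddGroup.eq_zero_iff] at hkz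
    obtain ⟨a, ha⟩ := mem_integerLattice.1 hkz
    refine mem_spanIntegerPoints.2 ⟨fun e => a e / k, fun i => ?_⟩
    have hk' : (k : ℝ) ≠ 0 := by positivity
    have h1 : (k : ℝ) * z i = ∑ e, (a e : ℝ) * y e i := by
      have := ha i
      simp only [Pi.smul_apply, nsmul_eq_mul] at this
      exact_mod_cast this
    simp_rw [div_mul_eq_mul_div, ← Finset.sum_div, ← h1]
    field_simp
  · rintro ⟨z', hz', hzz⟩
    rw [← hzz]
    choose w hw hwL using fun j : ℕ =>
      exists_mem_halfOpenBoxPoints_sub_mem ((spanIntegerPoints y).nsmul_mem hz' j)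
    have := (finite_halfOpenBoxPoints y).to_subtype
    obtain ⟨i, j, hij, he⟩ := Finite.exists_ne_map_eq_of_infinite
      (fun j : ℕ => (⟨w j, hw j⟩ : halfOpenBoxPoints y))
    have he' : w i = w j := congrArg Subtype.val he
    refine isOfFinAddOrder_iff_zsmul_eq_zero.2 ⟨(i : ℤ) - j, by omega, ?_⟩
    rw [← map_zsmul, QuotientAddGroup.mk'_apply, QuotientAddGroup.eq_zero_iff]
    have := (integerLattice y).sub_mem (hwL i) (hwL j)
    rw [he', sub_sub_sub_cancel_right] at this
    rwa [sub_zsmul, natCast_zsmul, natCast_zsmul]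

lemma relIndex_spanIntegerPoints (y : ι → Fin n → ℤ) :
    (integerLattice y).relIndex (spanIntegerPoints y) =
      Nat.card (AddCommGroup.torsion ((Fin n → ℤ) ⧸ integerLattice y)) := by
  rw [torsion_quotient_integerLattice, ← AddSubgroup.relIndex_ker, QuotientAddGroup.ker_mk']

lemma eq_of_linearIndependent_of_sum_eq {y : ι → Fin n → ℤ}
    (hy : LinearIndependent ℝ (fun e i => (y e i : ℝ))) {c d : ι → ℝ}
    (h : ∀ i, ∑ e, c e * (y e i : ℝ) = ∑ e, d e * y e i) : c = d := by
  have := Fintype.linearIndependent_iff.1 hy (fun e => c e - d e) (by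
    ext i
    simp [sub_mul, h i])
  exact funext fun e => sub_eq_zero.1 (this e)

lemma card_halfOpenBoxPoints {y : ι → Fin n → ℤ}
    (hy : LinearIndependent ℝ (fun e i => (y e i : ℝ))) :
    Nat.card (halfOpenBoxPoints y) = (integerLattice y).relIndex (spanIntegerPoints y) := by
  have hsub : halfOpenBoxPoints y ⊆ spanIntegerPoints y := fun z ⟨c, _, hz⟩ =>
    mem_spanIntegerPoints.2 ⟨c, hz⟩
  rw [relIndex_spanIntegerPoints, torsion_quotient_integerLattice]
  refine Nat.card_congr (Equiv.ofBijective
    (fun z => ⟨QuotientAddGroup.mk' _ z.1, AddSubgroup.mem_map_of_mem _ (hsub z.2)⟩) ⟨?_, ?_⟩)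
  · rintro ⟨z, c, hc, hz⟩ ⟨w, d, hd, hw⟩ h
    have h1 : (z : (Fin n → ℤ) ⧸ integerLattice y) = w := congrArg Subtype.val h
    obtain ⟨a, ha⟩ := mem_integerLattice.1 (QuotientAddGroup.eq.1 h1)
    have h2 : (fun e => d e) = fun e => c e + a e := by
      refine eq_of_linearIndependent_of_sum_eq hy fun i => ?_
      have hai := congrArg (Int.cast : ℤ → ℝ) (ha i)
      push_cast [Pi.add_apply, Pi.neg_apply] at hai
      simp only [add_mul, Finset.sum_add_distrib]
      rw [← hw i, ← hz i, ← hai]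
      ring
    have h3 : ∀ e, a e = 0 := by
      intro e
      have h4 := congrFun h2 e
      have h5 : (a e : ℝ) < 1 := by linarith [hc e, hd e]
      have h6 : (-1 : ℝ) < a e := by linarith [hc e, hd e]
      have h7 : a e < 1 := by exact_mod_cast h5
      have h8 : -1 < a e := by exact_mod_cast h6
      omega
    refine Subtype.ext (funext fun i => ?_)
    have := ha i
    simp only [h3, zero_mul, Finset.sum_const_zero, Pi.add_apply, Pi.neg_apply] at this
    change z i = w i
    omega
  · rintro ⟨q, z, hz, rfl⟩
    obtain ⟨w, hw, hzw⟩ := exists_mem_halfOpenBoxPoints_sub_mem hz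
    refine ⟨⟨w, hw⟩, Subtype.ext (QuotientAddGroup.eq.2 ?_)⟩
    rwa [neg_add_eq_sub]

lemma spanIntegerPoints_smul (y : ι → Fin n → ℤ) {k : ι → ℤ} (hk : ∀ e, k e ≠ 0) :
    spanIntegerPoints (fun e => k e • y e) = spanIntegerPoints y := by
  ext z
  simp only [mem_spanIntegerPoints, Pi.smul_apply, smul_eq_mul, Int.cast_mul]
  constructor
  · rintro ⟨c, hc⟩
    exact ⟨fun e => c e * k e, fun i => by simp only [hc i, mul_assoc]⟩
  · rintro ⟨c, hc⟩
    refine ⟨fun e => c e / k e, fun i => ?_⟩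
    rw [hc i]
    refine Finset.sum_congr rfl fun e _ => ?_
    have : (k e : ℝ) ≠ 0 := Int.cast_ne_zero.2 (hk e)
    field_simp

lemma integerLattice_smul (y : ι → Fin n → ℤ) (k : ι → ℤ) :
    integerLattice (fun e => k e • y e) =
      (AddSubgroup.pi Set.univ fun e => AddSubgroup.zmultiples (k e)).map
        (Fintype.linearCombination ℤ y).toAddMonoidHom := by
  ext z
  simp only [integerLattice, AddMonoidHom.mem_range, AddSubgroup.mem_map,
    LinearMap.toAddMonoidHom_coe, Fintype.linearCombination_apply, AddSubgroup.mem_pi,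
    Set.mem_univ, true_imp_iff, Int.mem_zmultiples_iff]
  constructor
  · rintro ⟨a, rfl⟩
    exact ⟨fun e => k e * a e, fun e => dvd_mul_right _ _,
      Finset.sum_congr rfl fun e _ => by rw [smul_smul, mul_comm]⟩
  · rintro ⟨b, hb, rfl⟩
    choose a ha using hb
    exact ⟨a, Finset.sum_congr rfl fun e _ => by rw [smul_smul, ha, mul_comm]⟩

lemma relIndex_integerLattice_smul {y : ι → Fin n → ℤ}
    (hy : LinearIndependent ℝ (fun e i => (y e i : ℝ))) (k : ι → ℤ) :
    (integerLattice (fun e => k e • y e)).relIndex (integerLattice y) = ∏ e, (k e).natAbs := by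
  have hinj : Function.Injective (Fintype.linearCombination ℤ y).toAddMonoidHom := by
    intro a b hab
    have h : (fun e => (a e : ℝ)) = fun e => (b e : ℝ) := by
      refine eq_of_linearIndependent_of_sum_eq hy fun i => ?_
      have := congrFun hab i
      simp only [LinearMap.toAddMonoidHom_coe, Fintype.linearCombination_apply,
        Finset.sum_apply, Pi.smul_apply, smul_eq_mul] at this
      exact_mod_cast this
    exact funext fun e => by exact_mod_cast congrFun h e
  rw [integerLattice_smul, integerLattice, AddMonoidHom.range_eq_map,
    AddSubgroup.relIndex_map_map_of_injective _ _ hinj, AddSubgroup.relIndex_top_right,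
    AddSubgroup.index_pi]
  simp [Int.index_zmultiples]

lemma card_halfOpenBoxPoints_smul {y : ι → Fin n → ℤ}
    (hy : LinearIndependent ℝ (fun e i => (y e i : ℝ))) {k : ι → ℤ} (hk : ∀ e, k e ≠ 0) :
    Nat.card (halfOpenBoxPoints (fun e => k e • y e)) = (∏ e, (k e).natAbs) *
      Nat.card (AddCommGroup.torsion ((Fin n → ℤ) ⧸ integerLattice y)) := by
  have hky : LinearIndependent ℝ (fun e i => (((k e • y e) i : ℤ) : ℝ)) := by
    rw [Fintype.linearIndependent_iff] at hy ⊢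
    intro g hg e
    have := hy (fun e => g e * k e) (by
      rw [← hg]
      ext i
      simp [mul_assoc]) e
    exact (mul_eq_zero.1 this).resolve_right (Int.cast_ne_zero.2 (hk e))
  have hle : integerLattice (fun e => k e • y e) ≤ integerLattice y := by
    rw [integerLattice_smul, integerLattice, AddMonoidHom.range_eq_map]
    exact AddSubgroup.map_mono le_top
  rw [card_halfOpenBoxPoints hky, spanIntegerPoints_smul y hk,
    ← AddSubgroup.relIndex_mul_relIndex _ _ _ hle (integerLattice_le_spanIntegerPoints y),
    relIndex_integerLattice_smul hy, relIndex_spanIntegerPoints]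

end HalfOpenZonotope

lemma halfOpenZonotopePts_eq_card_halfOpenBoxPoints {α : Type*} {n : ℕ}
    (x : α → Fin n → ℤ) (k : α → ℤ) (A : Finset α) :
    halfOpenZonotopePts x k A = Nat.card (halfOpenBoxPoints fun e : A => k e • x e) := by
  classical
  refine Nat.card_congr (Equiv.subtypeEquivRight fun z => ?_)
  constructor
  · rintro ⟨c, hc, hz⟩
    refine ⟨fun e => c e, fun e => hc e e.2, fun i => ?_⟩
    rw [congrFun hz i, ← Finset.sum_coe_sort]
    simp
  · rintro ⟨c, hc, hz⟩
    refine ⟨fun e => if h : e ∈ A then c ⟨e, h⟩ else 0, fun e he => ?_, funext fun i => ?_⟩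
    · simpa [he] using hc ⟨e, he⟩
    · rw [hz i, ← Finset.sum_coe_sort A]
      simp

lemma halfOpenZonotopePts_eq_prod_mul_card_torsion {α : Type*} {n : ℕ}
    {x : α → Fin n → ℤ} (hx : LinearIndependent ℝ (fun e i => (x e i : ℝ)))
    {k : α → ℤ} (hk : ∀ e, 0 < k e) (A : Finset α) :
    (halfOpenZonotopePts x k A : ℝ) =
      Nat.card (AddCommGroup.torsion ((Fin n → ℤ) ⧸ AddSubgroup.closure (x '' ↑A))) *
        ∏ e ∈ A, (k e : ℝ) := by
  have hxA : LinearIndependent ℝ (fun (e : A) i => (x e i : ℝ)) :=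
    hx.comp (Subtype.val : A → α) Subtype.val_injective
  have himage : x '' ↑A = Set.range fun e : A => x e := Set.image_eq_range x ↑A
  rw [halfOpenZonotopePts_eq_card_halfOpenBoxPoints,
    card_halfOpenBoxPoints_smul (y := fun e : A => x e) (k := fun e : A => k e) hxA
      (fun e => (hk e).ne'),
    himage, closure_range_eq_integerLattice, ← Finset.prod_coe_sort A, mul_comm]
  push_cast
  congr 1
  exact Finset.prod_congr rfl fun e _ => by
    rw [Nat.cast_natAbs, abs_of_pos (hk e)]


/-- **Theorem 3.9** (lattice points of a random half-open zonotope): let `E = (x_e)` be a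
finite family of vectors in `ℤ^n` that are linearly independent over `ℝ`, let
`m(A) = |(ℤ^n/⟨A⟩)_tor|` and let `k = (k_e)` be positive integers.  Then for every real
family `p` with `p_e ≠ 1` for all `e`,
`∑_{A⊆E} |Z(k·A)^⋄ ∩ ℤ^n| p^A (1−p)^{E∖A} = (1−p)^E Z_M(1, (k_e p_e/(1−p_e)))`,
and, equivalently, for all real `p`,
`∑_{A⊆E} |Z(k·A)^⋄ ∩ ℤ^n| p^A (1−p)^{E∖A} = ∑_{A⊆E} m(A) (∏_{e∈A} k_e) p^A (1−p)^{E∖A}`. -/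
theorem expected_halfopen_zonotope_points {α : Type*} [Fintype α] [DecidableEq α] {n : ℕ}
    (x : α → Fin n → ℤ)
    (hindep : LinearIndependent ℝ (fun e : α => fun i => (x e i : ℝ)))
    (k : α → ℤ) (hk : ∀ e, 0 < k e)
    (m : Finset α → ℝ)
    (hm : ∀ A : Finset α, m A =
      Nat.card ↥(AddCommGroup.torsion ((Fin n → ℤ) ⧸ AddSubgroup.closure (x '' ↑A))))
    (r : Finset α → ℤ)
    (hr : ∀ A : Finset α, r A =
      Module.finrank ℝ (Submodule.span ℝ ((fun e => fun i => ((x e i : ℤ) : ℝ)) '' ↑A))) :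
    (∀ p : α → ℝ, (∀ e, p e ≠ 1) →
      (∑ A : Finset α, (halfOpenZonotopePts x k A : ℝ) *
          (∏ e ∈ A, p e) * ∏ e ∈ Aᶜ, (1 - p e)) =
        (∏ e : α, (1 - p e)) *
          ∑ A : Finset α, m A * (1 : ℝ) ^ (-(r A)) *
            ∏ e ∈ A, ((k e : ℝ) * p e / (1 - p e))) ∧
    (∀ p : α → ℝ,
      (∑ A : Finset α, (halfOpenZonotopePts x k A : ℝ) *
          (∏ e ∈ A, p e) * ∏ e ∈ Aᶜ, (1 - p e)) =
        ∑ A : Finset α, m A * (∏ e ∈ A, (k e : ℝ)) *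
          (∏ e ∈ A, p e) * ∏ e ∈ Aᶜ, (1 - p e)) := by
  have hpts : ∀ A : Finset α,
      (halfOpenZonotopePts x k A : ℝ) = m A * ∏ e ∈ A, (k e : ℝ) := fun A => by
    rw [hm, halfOpenZonotopePts_eq_prod_mul_card_torsion hindep hk]
  refine ⟨fun p hp => ?_, fun p => Finset.sum_congr rfl fun A _ => by rw [hpts]⟩
  rw [Finset.mul_sum]
  refine Finset.sum_congr rfl fun A _ => ?_
  have hA : ∏ e ∈ A, (1 - p e) ≠ 0 :=
    Finset.prod_ne_zero_iff.2 fun e _ => sub_ne_zero.2 (hp e).symm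
  rw [hpts, ← Finset.prod_mul_prod_compl A fun e => 1 - p e, one_zpow, Finset.prod_div_distrib,
    Finset.prod_mul_distrib]
  field_simp
end

section
/- Let M=(E,r,m) be an rsm over a field K and t ∈ K with t ≠ 0. Then for all families u=(u_e)_{e∈E} and v=(v_e)_{e∈E} in K: Z_M(t, (u_e v_e)_{e∈E}) = ∑_{A⊆E} Z_{M|A}(t, u) · v^A (1−v)^{E∖A}. In particular, the expectation of the multivariate Tutte polynomial of the random restriction satisfies E[Z_{M|E_p}(t, u)] = Z_M(t, (p_e u_e)_{e∈E}) for every family p=(p_e)_{e∈E} in K. -/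
open Finset

/-- The probability that a random subset contains `B` is the product of the inclusion
probabilities of the elements of `B`. -/
theorem sum_superset_prod_mul_prod_one_sub {α R : Type*} [Fintype α] [DecidableEq α] [CommRing R]
    (v : α → R) (B : Finset α) :
    (∑ A : Finset α, if B ⊆ A then (∏ e ∈ A, v e) * ∏ e ∈ Aᶜ, (1 - v e) else 0) =
      ∏ e ∈ B, v e := by
  have h := Finset.prod_add v (fun e => if e ∈ B then 0 else 1 - v e) Finset.univ
  have hl : ∏ e, (v e + if e ∈ B then 0 else 1 - v e) = ∏ e ∈ B, v e := by
    rw [← Finset.prod_subset (Finset.subset_univ B)]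
    · exact Finset.prod_congr rfl fun e he => by simp [he]
    · intro e _ he
      simp [he]
  rw [hl, Finset.powerset_univ] at h
  rw [h]
  refine Finset.sum_congr rfl fun A _ => ?_
  rw [← Finset.compl_eq_univ_sdiff]
  split_ifs with hBA
  · congr 1
    refine Finset.prod_congr rfl fun e he => ?_
    rw [if_neg fun heB => Finset.mem_compl.mp he (hBA heB)]
  · obtain ⟨e, heB, heA⟩ := Finset.not_subset.mp hBA
    rw [Finset.prod_eq_zero (Finset.mem_compl.mpr heA) (by rw [if_pos heB]), mul_zero]

/-- The expected multivariate Tutte polynomial of a random restriction. -/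
theorem sum_ZmultiRes_mul_prod {α K : Type*} [Fintype α] [DecidableEq α] [Field K]
    (r : Finset α → ℤ) (m : Finset α → K) (t : K) (u v : α → K) :
    (∑ A : Finset α, ZmultiRes r m A t u * (∏ e ∈ A, v e) * ∏ e ∈ Aᶜ, (1 - v e)) =
      Zmulti r m t (fun e => u e * v e) := by
  have hZ : Zmulti r m t (fun e => u e * v e) = ∑ B : Finset α, ∑ A : Finset α,
      m B * t ^ (-(r B)) * (∏ e ∈ B, u e) *
        if B ⊆ A then (∏ e ∈ A, v e) * ∏ e ∈ Aᶜ, (1 - v e) else 0 := by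
    refine Finset.sum_congr rfl fun B _ => ?_
    rw [← Finset.mul_sum, sum_superset_prod_mul_prod_one_sub, Finset.prod_mul_distrib, mul_assoc,
      mul_assoc, mul_assoc]
  rw [hZ, Finset.sum_comm]
  refine Finset.sum_congr rfl fun A _ => ?_
  have hA : A.powerset = Finset.univ.filter (· ⊆ A) := by ext; simp
  rw [ZmultiRes, hA, Finset.sum_filter, mul_assoc, Finset.sum_mul]
  exact Finset.sum_congr rfl fun B _ => by split_ifs <;> simp

/-- **Theorem 3.10**: for an rsm `M = (E,r,m)` over a field `K` and `t ≠ 0`,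
`Z_M(t, uv) = ∑_{A⊆E} Z_{M|A}(t,u) v^A (1−v)^{E∖A}` for all families `u, v`; in particular
the expectation of the multivariate Tutte polynomial of the random restriction is
`E[Z_{M|E_p}(t,u)] = Z_M(t, (p_e u_e))` for every family `p`. -/
theorem expectation_Zmulti_restriction {α K : Type*} [Fintype α] [DecidableEq α] [Field K]
    (r : Finset α → ℤ) (m : Finset α → K) (t : K) (ht : t ≠ 0) (u : α → K) :
    (∀ v : α → K,
      Zmulti r m t (fun e => u e * v e) =
        ∑ A : Finset α, ZmultiRes r m A t u * (∏ e ∈ A, v e) * ∏ e ∈ Aᶜ, (1 - v e)) ∧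
    (∀ p : α → K,
      (∑ A : Finset α, ZmultiRes r m A t u * (∏ e ∈ A, p e) * ∏ e ∈ Aᶜ, (1 - p e)) =
        Zmulti r m t (fun e => p e * u e)) := by
  refine ⟨fun v => (sum_ZmultiRes_mul_prod r m t u v).symm, fun p => ?_⟩
  simpa only [mul_comm (p _)] using sum_ZmultiRes_mul_prod r m t u p
end

section
/- Let E be a finite indexed family of vectors in ℤ^n, and for A ⊆ E set m(A) := |(ℤ^n/⟨A⟩)_tor|. For S ⊆ E and a family v=(v_e)_{e∈E} of reals, let Ehr_S(v) := ∑_{B ⊆ S, B linearly independent over ℝ} m(B) v^B be the Brändén–Moci multivariate Ehrhart polynomial of the zonotope of S. Then for all real families v=(v_e) and p=(p_e): ∑_{A⊆E} Ehr_A(v) · p^A (1−p)^{E∖A} = Ehr_E((p_e v_e)_{e∈E}). -/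
open Finset

open scoped Classical in
/-- The Brändén–Moci multivariate Ehrhart polynomial of the zonotope of `S ⊆ E`:
`Ehr_S(v) = ∑_{B⊆S, B independent} m(B) v^B`, where a subset `B` is independent if the
vectors `(x_b)_{b∈B}` are linearly independent over `ℝ`. -/
noncomputable def EhrBM {α : Type*} {n : ℕ} (x : α → Fin n → ℤ)
    (m : Finset α → ℝ) (S : Finset α) (v : α → ℝ) : ℝ :=
  ∑ B ∈ S.powerset,
    if LinearIndependent ℝ (fun b : {a // a ∈ B} => fun i => ((x b i : ℤ) : ℝ))
    then m B * ∏ e ∈ B, v e else 0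

/-- If each `e` is kept independently with probability `p e`, then the kept set contains `B` with
probability `∏ e ∈ B, p e`. -/
theorem sum_ite_subset_prod_mul_prod_compl {α R : Type*} [Fintype α] [DecidableEq α] [CommRing R]
    (p : α → R) (B : Finset α) :
    (∑ A : Finset α, if B ⊆ A then (∏ e ∈ A, p e) * ∏ e ∈ Aᶜ, (1 - p e) else 0) =
      ∏ e ∈ B, p e := by
  calc
    _ = ∑ A : Finset α, (∏ e ∈ A, p e) * ∏ e ∈ Aᶜ, (if e ∈ B then 0 else 1 - p e) := by
      refine sum_congr rfl fun A _ => ?_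
      split_ifs with h
      · congr 1
        refine prod_congr rfl fun e he => ?_
        rw [if_neg fun heB => mem_compl.1 he (h heB)]
      · obtain ⟨e, heB, heA⟩ := not_subset.1 h
        rw [prod_eq_zero (i := e) (mem_compl.2 heA) (by rw [if_pos heB]), mul_zero]
    _ = ∏ e, (p e + if e ∈ B then 0 else 1 - p e) := by
      rw [prod_add, powerset_univ]
      simp only [compl_eq_univ_sdiff]
    _ = ∏ e, (if e ∈ B then p e else 1) := by
      refine prod_congr rfl fun e _ => ?_
      split_ifs <;> ring
    _ = ∏ e ∈ B, p e := by simp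

/-- **Theorem 3.12** (expected multivariate Ehrhart polynomial): let `E = (x_e)` be a finite
family of vectors in `ℤ^n` and `m(A) = |(ℤ^n/⟨A⟩)_tor|`.  Then for all real families
`v` and `p`: `∑_{A⊆E} Ehr_A(v) p^A (1−p)^{E∖A} = Ehr_E((p_e v_e))`. -/
theorem expected_Ehrhart {α : Type*} [Fintype α] [DecidableEq α] {n : ℕ}
    (x : α → Fin n → ℤ)
    (m : Finset α → ℝ)
    (hm : ∀ A : Finset α, m A =
      Nat.card ↥(AddCommGroup.torsion ((Fin n → ℤ) ⧸ AddSubgroup.closure (x '' ↑A))))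
    (v p : α → ℝ) :
    (∑ A : Finset α, EhrBM x m A v * (∏ e ∈ A, p e) * ∏ e ∈ Aᶜ, (1 - p e)) =
      EhrBM x m Finset.univ (fun e => p e * v e) := by
  classical
  have hE (A : Finset α) (w : α → ℝ) : EhrBM x m A w = ∑ B : Finset α, if B ⊆ A then
      (if LinearIndependent ℝ (fun b : {a // a ∈ B} => fun i => ((x b i : ℤ) : ℝ))
        then m B * ∏ e ∈ B, w e else 0) else 0 := by
    rw [EhrBM, ← sum_filter (fun B => B ⊆ A)]
    exact sum_congr (by ext; simp) fun B _ => rfl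
  simp only [hE, sum_mul]
  rw [sum_comm]
  refine sum_congr rfl fun B _ => ?_
  rw [if_pos (subset_univ B)]
  split_ifs with hB
  · rw [prod_mul_distrib, ← sum_ite_subset_prod_mul_prod_compl p B, sum_mul, mul_sum]
    refine sum_congr rfl fun A _ => ?_
    split_ifs <;> ring
  · simp
end

section
/- Let M=(E,r,m) be an rsm over a field K and x, y ∈ K with x ≠ 0 and y ≠ 0. Define the rank-nullity polynomial W_{M|A}(x,y) := ∑_{B⊆A} m(B) x^{r(B)} y^{|B|−r(B)} (integer zpow powers) for A ⊆ E. Then for every family p=(p_e)_{e∈E} in K: E[W_{M|E_p}(x,y)] = ∑_{A⊆E} W_{M|A}(x,y) p^A (1−p)^{E∖A} = Z_M(y/x, (p_e y)_{e∈E}). -/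
open Finset

/-- The rank-nullity polynomial of the restriction `M|A`:
`W_{M|A}(x,y) = ∑_{B⊆A} m(B) x^{r(B)} y^{|B|−r(B)}` (integer powers). -/
noncomputable def rankNullityRes {α K : Type*} [Field K]
    (r : Finset α → ℤ) (m : Finset α → K) (A : Finset α) (x y : K) : K :=
  ∑ B ∈ A.powerset, m B * x ^ (r B) * y ^ ((B.card : ℤ) - r B)

/-- The probability that the random subset with inclusion probabilities `p` contains `B` is
`∏ e ∈ B, p e`. -/
theorem sum_superset_prod_mul_prod_compl {α K : Type*} [Fintype α] [DecidableEq α] [CommRing K]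
    (p : α → K) (B : Finset α) :
    (∑ A : Finset α, if B ⊆ A then (∏ e ∈ A, p e) * ∏ e ∈ Aᶜ, (1 - p e) else 0) =
      ∏ e ∈ B, p e := by
  have h := Fintype.prod_add p fun e => if e ∈ B then 0 else 1 - p e
  have hB : ∏ e, (p e + if e ∈ B then 0 else 1 - p e) = ∏ e ∈ B, p e := by
    rw [← Finset.prod_subset (Finset.subset_univ B)]
    · exact Finset.prod_congr rfl fun e he => by simp [he]
    · intro e _ he
      simp [he]
  rw [← hB, h]
  refine Finset.sum_congr rfl fun A _ => ?_
  split_ifs with hBA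
  · congr 1
    refine Finset.prod_congr rfl fun e he => ?_
    rw [if_neg fun heB => Finset.mem_compl.mp he (hBA heB)]
  · obtain ⟨e, heB, heA⟩ := Finset.not_subset.mp hBA
    rw [Finset.prod_eq_zero (i := e) (Finset.mem_compl.mpr heA) (by simp [heB]), mul_zero]

/-- **Corollary 3.15** (expected rank-nullity polynomial): for an rsm `M = (E,r,m)` over a
field `K`, `x ≠ 0`, `y ≠ 0` and every family `p`,
`E[W_{M|E_p}(x,y)] = ∑_{A⊆E} W_{M|A}(x,y) p^A (1−p)^{E∖A} = Z_M(y/x, (p_e y))`. -/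
theorem expectation_rank_nullity {α K : Type*} [Fintype α] [DecidableEq α] [Field K]
    (r : Finset α → ℤ) (m : Finset α → K) (x y : K) (hx : x ≠ 0) (hy : y ≠ 0)
    (p : α → K) :
    (∑ A : Finset α, rankNullityRes r m A x y * (∏ e ∈ A, p e) * ∏ e ∈ Aᶜ, (1 - p e)) =
      Zmulti r m (y / x) (fun e => p e * y) := by
  have hres (A : Finset α) : rankNullityRes r m A x y =
      ∑ B, if B ⊆ A then m B * x ^ r B * y ^ ((B.card : ℤ) - r B) else 0 := by
    rw [rankNullityRes, ← Finset.sum_filter]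
    congr 1
    ext B
    simp
  simp_rw [hres, mul_assoc _ (∏ e ∈ _, p e), Finset.sum_mul]
  rw [Finset.sum_comm, Zmulti]
  refine Finset.sum_congr rfl fun B _ => ?_
  have hterm (c : K) (A : Finset α) (t : K) :
      (if B ⊆ A then c else 0) * t = c * if B ⊆ A then t else 0 := by
    split_ifs <;> simp
  simp_rw [hterm]
  rw [← Finset.mul_sum, sum_superset_prod_mul_prod_compl, Finset.prod_mul_distrib,
    Finset.prod_const, zpow_sub₀ hy, zpow_natCast, div_zpow, zpow_neg, zpow_neg]
  have := zpow_ne_zero (r B) hx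
  have := zpow_ne_zero (r B) hy
  field_simp
end

section
/- Let M=(E,r,m) be an rsm over a field K and s ∈ K with s ≠ 0. Then for all families u=(u_e)_{e∈E} and v=(v_e)_{e∈E} in K: Z_M(s, (u_e v_e)_{e∈E}) = ∑_{A⊆E} s^{−r(A)} · (∏_{e∈A}(−v_e)) · (∏_{e∈A}(1−u_e)) · Z_{M/A}(s, v). -/
open Finset

/-- Summing over pairs of disjoint subsets is summing over a set together with one of its subsets. -/
theorem sum_sum_powerset_compl {α M : Type*} [Fintype α] [DecidableEq α] [AddCommMonoid M]
    (f : Finset α → Finset α → M) :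
    ∑ A : Finset α, ∑ B ∈ Aᶜ.powerset, f A B =
      ∑ C : Finset α, ∑ A ∈ C.powerset, f A (C \ A) := by
  rw [Finset.sum_sigma', Finset.sum_sigma']
  refine Finset.sum_bij' (fun p _ => ⟨p.1 ∪ p.2, p.1⟩) (fun p _ => ⟨p.2, p.1 \ p.2⟩) ?_ ?_ ?_ ?_ ?_
  · exact fun p _ => mem_sigma.mpr ⟨mem_univ _, mem_powerset.mpr subset_union_left⟩
  · simp only [mem_sigma, mem_univ, true_and, mem_powerset]
    intro p _ x hx
    simp_all
  · rintro ⟨A, B⟩ h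
    have hAB : Disjoint A B :=
      subset_compl_iff_disjoint_left.mp (mem_powerset.mp (mem_sigma.mp h).2)
    simp [union_sdiff_cancel_left hAB]
  · rintro ⟨C, A⟩ h
    have hAC : A ⊆ C := by simpa using h
    simp [union_sdiff_of_subset hAC]
  · rintro ⟨A, B⟩ h
    have hAB : Disjoint A B :=
      subset_compl_iff_disjoint_left.mp (mem_powerset.mp (mem_sigma.mp h).2)
    simp [union_sdiff_cancel_left hAB]

/-- **Proposition 3.22**: for an rsm `M = (E,r,m)` over a field `K`, `s ≠ 0` and all
families `u, v`,
`Z_M(s, uv) = ∑_{A⊆E} s^{−r(A)} (−v)^A (1−u)^A Z_{M/A}(s, v)`. -/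
theorem Zmulti_contraction_expansion {α K : Type*} [Fintype α] [DecidableEq α] [Field K]
    (r : Finset α → ℤ) (m : Finset α → K) (s : K) (hs : s ≠ 0) (u v : α → K) :
    Zmulti r m s (fun e => u e * v e) =
      ∑ A : Finset α, s ^ (-(r A)) * (∏ e ∈ A, (-v e)) * (∏ e ∈ A, (1 - u e)) *
        ZmultiCon r m A s v := by
  simp only [ZmultiCon, Finset.mul_sum]
  rw [sum_sum_powerset_compl, Zmulti]
  refine Finset.sum_congr rfl fun C _ => ?_
  have hprod : ∏ e ∈ C, u e * v e =
      ∑ A ∈ C.powerset, (∏ e ∈ A, (-v e) * (1 - u e)) * ∏ e ∈ C \ A, v e := by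
    rw [← Finset.prod_add]
    exact Finset.prod_congr rfl fun e _ => by ring
  rw [hprod, Finset.mul_sum]
  refine Finset.sum_congr rfl fun A hA => ?_
  have hs' : s ^ (-(r C)) = s ^ (-(r A)) * s ^ (r A - r C) := by
    rw [← zpow_add₀ hs]
    congr 1
    ring
  rw [union_sdiff_of_subset (mem_powerset.mp hA), hs', Finset.prod_mul_distrib]
  ring
end

section
/- Let M=(E,r,m) be an rsm over a field K and s ∈ K with s ≠ 0. Define the characteristic polynomial of the contraction M/A by P_{M/A}(s) := ∑_{B⊆E∖A} (−1)^{|B|} m(A∪B) s^{r(E)−r(A∪B)} (integer zpow powers). Then for every family u=(u_e)_{e∈E} in K: s^{r(E)} · Z_M(s, (−u_e)_{e∈E}) = ∑_{A⊆E} (∏_{e∈A}(1−u_e)) · P_{M/A}(s). -/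
open Finset

/-- The characteristic polynomial of the contraction `M/A` of an rsm `M = (E,r,m)`:
`P_{M/A}(s) = ∑_{B⊆E∖A} (−1)^{|B|} m(A∪B) s^{r(E)−r(A∪B)}` (integer powers). -/
noncomputable def charPolyCon {α K : Type*} [Fintype α] [DecidableEq α] [Field K]
    (r : Finset α → ℤ) (m : Finset α → K) (A : Finset α) (s : K) : K :=
  ∑ B ∈ Aᶜ.powerset, (-1 : K) ^ B.card * m (A ∪ B) * s ^ (r Finset.univ - r (A ∪ B))

theorem charPolyCon_eq_sum_superset {α K : Type*} [Fintype α] [DecidableEq α] [Field K]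
    (r : Finset α → ℤ) (m : Finset α → K) (A : Finset α) (s : K) :
    charPolyCon r m A s =
      ∑ C with A ⊆ C, (-1 : K) ^ (C \ A).card * m C * s ^ (r Finset.univ - r C) := by
  unfold charPolyCon
  refine Finset.sum_bij' (fun B _ => A ∪ B) (fun C _ => C \ A) ?_ ?_ ?_ ?_ ?_
  · intro B _
    simp
  · intro C _
    simp only [mem_powerset]
    intro x hx
    simp_all
  · intro B hB
    rw [mem_powerset, subset_compl_iff_disjoint_left] at hB
    exact union_sdiff_cancel_left hB
  · intro C hC
    exact union_sdiff_of_subset (by simpa using hC)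
  · intro B hB
    rw [mem_powerset, subset_compl_iff_disjoint_left] at hB
    rw [union_sdiff_cancel_left hB]

theorem prod_neg_eq_sum_powerset {α K : Type*} [DecidableEq α] [CommRing K]
    (u : α → K) (C : Finset α) :
    ∏ e ∈ C, (-u e) = ∑ A ∈ C.powerset, (∏ e ∈ A, (1 - u e)) * (-1) ^ (C \ A).card := by
  have h := Finset.prod_add (fun e => 1 - u e) (fun _ => (-1 : K)) C
  simpa only [prod_const, sub_add_cancel_left, sub_add_eq_add_sub, add_neg_cancel, zero_sub] using h

/-- **Corollary 3.23**: for an rsm `M = (E,r,m)` over a field `K`, `s ≠ 0`, and every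
family `u`,
`s^{r(E)} Z_M(s, (−u_e)) = ∑_{A⊆E} (∏_{e∈A}(1−u_e)) P_{M/A}(s)`. -/
theorem charPoly_contraction_sum {α K : Type*} [Fintype α] [DecidableEq α] [Field K]
    (r : Finset α → ℤ) (m : Finset α → K) (s : K) (hs : s ≠ 0) (u : α → K) :
    s ^ (r Finset.univ) *
        (∑ A : Finset α, m A * s ^ (-(r A)) * ∏ e ∈ A, (-u e)) =
      ∑ A : Finset α, (∏ e ∈ A, (1 - u e)) * charPolyCon r m A s := by
  simp only [charPolyCon_eq_sum_superset, prod_neg_eq_sum_powerset, mul_sum]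
  conv_rhs => rw [Finset.sum_comm' (t' := Finset.univ) (s' := fun C => C.powerset) (by simp)]
  refine sum_congr rfl fun C _ => sum_congr rfl fun A _ => ?_
  rw [sub_eq_add_neg, zpow_add₀ hs]
  ring
end

section
/- Let M=(E,r,m) be an rsm over a field K and s ∈ K with s ≠ 0, and let P_{M/A}(s) := ∑_{B⊆E∖A} (−1)^{|B|} m(A∪B) s^{r(E)−r(A∪B)} be the characteristic polynomial of the contraction M/A. Then for every family u=(u_e)_{e∈E} in K: ∑_{A⊆E} P_{M/A}(s) · u^A (1−u)^{E∖A} = ∑_{B⊆E} m(B) s^{r(E)−r(B)} (∏_{e∈B}(2u_e−1)) (∏_{e∈E∖B}(1−u_e)). In particular, if u_e ≠ 1 for all e, the right-hand side equals s^{r(E)} (1−u)^E · Z_M(s, ((2u_e−1)/(1−u_e))_{e∈E}), so the expectation of the characteristic polynomial of the random contraction is E[P_{M/E_p}(s)] = s^{r(E)} (1−p)^E Z_M(s, ((2p_e−1)/(1−p_e))_{e∈E}) whenever p_e ≠ 1 for all e. -/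
open Finset

/-- The subsets of `Aᶜ` correspond to the supersets of `A`, via `B ↦ A ∪ B`. -/
lemma sum_powerset_compl_eq_sum_supersets {α M : Type*} [Fintype α] [DecidableEq α]
    [AddCommMonoid M] (A : Finset α) (f : Finset α → Finset α → M) :
    ∑ B ∈ Aᶜ.powerset, f B (A ∪ B) = ∑ C with A ⊆ C, f (C \ A) C := by
  refine Finset.sum_bij' (fun B _ => A ∪ B) (fun C _ => C \ A) ?_ ?_ ?_ ?_ ?_
  · intro B _
    simp
  · intro C _
    simp only [mem_powerset]
    intro x hx
    simp_all
  · intro B hB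
    rw [mem_powerset] at hB
    exact union_sdiff_cancel_left (disjoint_left.2 fun x hx hxB => mem_compl.1 (hB hxB) hx)
  · intro C hC
    exact union_sdiff_of_subset (by simpa using hC)
  · intro B hB
    rw [mem_powerset] at hB
    rw [union_sdiff_cancel_left (disjoint_left.2 fun x hx hxB => mem_compl.1 (hB hxB) hx)]

/-- Expansion of `∏_{e∈C}(2u_e−1) ∏_{e∉C}(1−u_e)` over the subsets of `C`,
by writing `2u_e − 1 = u_e − (1 − u_e)`. -/
lemma sum_powerset_neg_one_pow_mul_prod {α K : Type*} [Fintype α] [DecidableEq α] [CommRing K]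
    (u : α → K) (C : Finset α) :
    ∑ A ∈ C.powerset, (-1 : K) ^ (C \ A).card * (∏ e ∈ A, u e) * ∏ e ∈ Aᶜ, (1 - u e) =
      (∏ e ∈ C, (2 * u e - 1)) * ∏ e ∈ Cᶜ, (1 - u e) := by
  have h : ∏ e ∈ C, (2 * u e - 1) = ∏ e ∈ C, (u e + -(1 - u e)) :=
    prod_congr rfl fun e _ => by ring
  rw [h, prod_add, sum_mul]
  refine sum_congr rfl fun A hA => ?_
  rw [mem_powerset] at hA
  have hc : Aᶜ \ (C \ A) = Cᶜ := by
    ext x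
    have := @hA x
    simp only [mem_sdiff, mem_compl]
    tauto
  have hs : C \ A ⊆ Aᶜ := fun x hx => mem_compl.2 (mem_sdiff.1 hx).2
  rw [prod_neg, ← prod_sdiff hs, hc]
  ring

/-- **Theorem 3.24** (expected characteristic polynomial of a random contraction): for an
rsm `M = (E,r,m)` over a field `K`, `s ≠ 0`, and every family `u`,
`∑_{A⊆E} P_{M/A}(s) u^A (1−u)^{E∖A}
  = ∑_{B⊆E} m(B) s^{r(E)−r(B)} (∏_{e∈B}(2u_e−1)) (∏_{e∈E∖B}(1−u_e))`;
in particular, if `u_e ≠ 1` for all `e`, then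
`E[P_{M/E_u}(s)] = s^{r(E)} (1−u)^E Z_M(s, ((2u_e−1)/(1−u_e)))`. -/
theorem expectation_charPoly_contraction {α K : Type*} [Fintype α] [DecidableEq α] [Field K]
    (r : Finset α → ℤ) (m : Finset α → K) (s : K) (hs : s ≠ 0) (u : α → K) :
    ((∑ A : Finset α, charPolyCon r m A s * (∏ e ∈ A, u e) * ∏ e ∈ Aᶜ, (1 - u e)) =
        ∑ B : Finset α, m B * s ^ (r Finset.univ - r B) *
          (∏ e ∈ B, (2 * u e - 1)) * ∏ e ∈ Bᶜ, (1 - u e)) ∧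
    ((∀ e, u e ≠ 1) →
      (∑ A : Finset α, charPolyCon r m A s * (∏ e ∈ A, u e) * ∏ e ∈ Aᶜ, (1 - u e)) =
        s ^ (r Finset.univ) * (∏ e : α, (1 - u e)) *
          ∑ A : Finset α, m A * s ^ (-(r A)) *
            ∏ e ∈ A, ((2 * u e - 1) / (1 - u e))) := by
  have key : (∑ A : Finset α, charPolyCon r m A s * (∏ e ∈ A, u e) * ∏ e ∈ Aᶜ, (1 - u e)) =
      ∑ B : Finset α, m B * s ^ (r Finset.univ - r B) *
        (∏ e ∈ B, (2 * u e - 1)) * ∏ e ∈ Bᶜ, (1 - u e) := by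
    simp only [charPolyCon, sum_mul]
    simp_rw [fun A => sum_powerset_compl_eq_sum_supersets A fun B C =>
      (-1 : K) ^ B.card * m C * s ^ (r Finset.univ - r C) * (∏ e ∈ A, u e) *
        ∏ e ∈ Aᶜ, (1 - u e)]
    rw [Finset.sum_comm' (t' := Finset.univ) (s' := fun C => C.powerset) (by simp)]
    refine sum_congr rfl fun C _ => ?_
    rw [mul_assoc, ← sum_powerset_neg_one_pow_mul_prod, mul_sum]
    exact sum_congr rfl fun A _ => by ring
  refine ⟨key, fun hu => ?_⟩
  rw [key, mul_sum]
  refine sum_congr rfl fun B _ => ?_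
  have hB : ∏ e ∈ B, (1 - u e) ≠ 0 :=
    prod_ne_zero_iff.2 fun e _ => sub_ne_zero.2 (hu e).symm
  rw [prod_div_distrib, ← prod_mul_prod_compl B, sub_eq_add_neg, zpow_add₀ hs]
  field_simp
end

section
/- Let Γ be a finitely generated abelian group of rank r(Γ), E a finite indexed family of elements of Γ with r(A) := rank(⟨A⟩) for A ⊆ E, and m : 2^E → ℝ any function. Define the chromatic polynomial of the contraction M/A by χ_{M/A}(s) := ∑_{B⊆E∖A} (−1)^{|B|} m(A∪B) s^{r(Γ)−r(A∪B)} (all exponents nonnegative). Then for every s ∈ ℝ and every family p=(p_e)_{e∈E} of reals: E[χ_{M/E_p}(s)] = ∑_{A⊆E} χ_{M/A}(s) p^A (1−p)^{E∖A} = ∑_{B⊆E} m(B) s^{r(Γ)−r(B)} (∏_{e∈B}(2p_e−1)) (∏_{e∈E∖B}(1−p_e)); for s ≠ 0 and p_e ≠ 1 for all e, this equals s^{r(Γ)} (1−p)^E · Z_M(s, ((2p_e−1)/(1−p_e))_{e∈E}). -/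
open Finset

/-- Summing `f A B` over disjoint pairs `(A, B)` amounts to summing over `C = A ∪ B`
and `A ⊆ C`. -/
theorem sum_powerset_compl_union {α R : Type*} [Fintype α] [DecidableEq α] [AddCommMonoid R]
    (f : Finset α → Finset α → R) :
    ∑ A : Finset α, ∑ B ∈ Aᶜ.powerset, f A B =
      ∑ C : Finset α, ∑ A ∈ C.powerset, f A (C \ A) := by
  rw [Finset.sum_sigma', Finset.sum_sigma']
  refine Finset.sum_nbij' (fun z => ⟨z.1 ∪ z.2, z.1⟩) (fun z => ⟨z.2, z.1 \ z.2⟩) ?_ ?_ ?_ ?_ ?_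
  · rintro ⟨A, B⟩ -
    simp only [mem_sigma, mem_univ, mem_powerset, true_and, subset_union_left]
  · rintro ⟨C, A⟩ -
    simp only [mem_sigma, mem_univ, mem_powerset, true_and]
    intro e he
    simp_all
  · rintro ⟨A, B⟩ h
    simp only [mem_sigma, mem_univ, mem_powerset, true_and, subset_compl_iff_disjoint_right] at h
    simp [union_sdiff_cancel_left h.symm]
  · rintro ⟨C, A⟩ h
    simp only [mem_sigma, mem_univ, mem_powerset, true_and] at h
    simp [union_sdiff_of_subset h]
  · rintro ⟨A, B⟩ h
    simp only [mem_sigma, mem_univ, mem_powerset, true_and, subset_compl_iff_disjoint_right] at h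
    simp [union_sdiff_cancel_left h.symm]

/-- The expectation over a random subset of the alternating sum of `g` over its supersets. -/
theorem sum_alternating_union_mul_prod {α R : Type*} [Fintype α] [DecidableEq α] [CommRing R]
    (g : Finset α → R) (p : α → R) :
    ∑ A : Finset α, (∑ B ∈ Aᶜ.powerset, (-1) ^ B.card * g (A ∪ B)) *
        (∏ e ∈ A, p e) * ∏ e ∈ Aᶜ, (1 - p e) =
      ∑ C : Finset α, g C * (∏ e ∈ C, (2 * p e - 1)) * ∏ e ∈ Cᶜ, (1 - p e) := by
  simp_rw [Finset.sum_mul]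
  rw [sum_powerset_compl_union]
  refine Finset.sum_congr rfl fun C _ => ?_
  have h : ∏ e ∈ C, (2 * p e - 1) =
      ∑ A ∈ C.powerset, (∏ e ∈ A, p e) * ∏ e ∈ C \ A, (p e - 1) := by
    rw [← Finset.prod_add]
    exact Finset.prod_congr rfl fun e _ => by ring
  rw [h, Finset.mul_sum, Finset.sum_mul]
  refine Finset.sum_congr rfl fun A hA => ?_
  rw [mem_powerset] at hA
  have hneg : ∏ e ∈ C \ A, (p e - 1) = (-1) ^ (C \ A).card * ∏ e ∈ C \ A, (1 - p e) := by
    rw [← Finset.prod_const, ← Finset.prod_mul_distrib]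
    exact Finset.prod_congr rfl fun e _ => by ring
  have hcompl : ∏ e ∈ Aᶜ, (1 - p e) = (∏ e ∈ C \ A, (1 - p e)) * ∏ e ∈ Cᶜ, (1 - p e) := by
    rw [← Finset.prod_union (disjoint_compl_right.mono_left sdiff_subset)]
    congr 1
    ext e
    have := @hA e
    simp only [mem_compl, mem_union, mem_sdiff]
    tauto
  rw [union_sdiff_of_subset hA, hneg, hcompl]
  ring

/-- **Corollary 3.25** (expected chromatic polynomial of a random contraction): let `Γ` be
a finitely generated abelian group of rank `r(Γ)`, `E = (x_e)` a finite family of elements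
of `Γ` with `r(A) = rank ⟨A⟩`, and `m : 2^E → ℝ` any multiplicity.  With the chromatic
polynomial of the contraction
`χ_{M/A}(s) = ∑_{B⊆E∖A} (−1)^{|B|} m(A∪B) s^{r(Γ)−r(A∪B)}`, for every `s ∈ ℝ` and every
real family `p`:
`E[χ_{M/E_p}(s)] = ∑_{A⊆E} χ_{M/A}(s) p^A (1−p)^{E∖A}
  = ∑_{B⊆E} m(B) s^{r(Γ)−r(B)} (∏_{e∈B}(2p_e−1)) (∏_{e∈E∖B}(1−p_e))`,
and for `s ≠ 0` and `p_e ≠ 1` for all `e`, this equals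
`s^{r(Γ)} (1−p)^E Z_M(s, ((2p_e−1)/(1−p_e)))`. -/
theorem expectation_chromatic_contraction {Γ : Type*} [AddCommGroup Γ] [AddGroup.FG Γ]
    {α : Type*} [Fintype α] [DecidableEq α] (x : α → Γ)
    (r : Finset α → ℤ)
    (hr : ∀ A : Finset α, r A = Module.finrank ℤ ↥(AddSubgroup.closure (x '' ↑A)))
    (rΓ : ℤ) (hrΓ : rΓ = Module.finrank ℤ Γ)
    (m : Finset α → ℝ) (s : ℝ) (p : α → ℝ) :
    ((∑ A : Finset α,
        (∑ B ∈ Aᶜ.powerset, (-1 : ℝ) ^ B.card * m (A ∪ B) * s ^ (rΓ - r (A ∪ B))) *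
          (∏ e ∈ A, p e) * ∏ e ∈ Aᶜ, (1 - p e)) =
      ∑ B : Finset α, m B * s ^ (rΓ - r B) *
        (∏ e ∈ B, (2 * p e - 1)) * ∏ e ∈ Bᶜ, (1 - p e)) ∧
    (s ≠ 0 → (∀ e, p e ≠ 1) →
      (∑ A : Finset α,
          (∑ B ∈ Aᶜ.powerset, (-1 : ℝ) ^ B.card * m (A ∪ B) * s ^ (rΓ - r (A ∪ B))) *
            (∏ e ∈ A, p e) * ∏ e ∈ Aᶜ, (1 - p e)) =
        s ^ rΓ * (∏ e : α, (1 - p e)) *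
          ∑ A : Finset α, m A * s ^ (-(r A)) *
            ∏ e ∈ A, ((2 * p e - 1) / (1 - p e))) := by
  have main := sum_alternating_union_mul_prod (fun C => m C * s ^ (rΓ - r C)) p
  simp only [← mul_assoc] at main
  refine ⟨main, fun hs hp => main.trans ?_⟩
  rw [Finset.mul_sum]
  refine Finset.sum_congr rfl fun C _ => ?_
  have hC : ∏ e ∈ C, (1 - p e) ≠ 0 :=
    Finset.prod_ne_zero_iff.mpr fun e _ => sub_ne_zero.mpr (hp e).symm
  rw [← Finset.prod_mul_prod_compl C, Finset.prod_div_distrib, sub_eq_add_neg, zpow_add₀ hs]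
  field_simp
end
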